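/- Let d ≥ 1 be an integer. For every smooth compactly supported function g : ℝ^d → ℝ and every C¹ vector field F : ℝ^d → ℝ^d, the Pohozaev identity holds: ∫_{ℝ^d} Δg (F·∇g) dx = − Σ_{i,j=1}^d ∫_{ℝ^d} (∂_i F_j)(∂_i g)(∂_j g) dx + (1/2)∫_{ℝ^d} |∇g|² (∇·F) dx. -/

import Mathlib

open MeasureTheory

noncomputable section

/-- Partial derivative in the `i`-th coordinate direction on ℝ^d. -/
def coordDeriv (d : ℕ) (i : Fin d) (f : EuclideanSpace ℝ (Fin d) → ℝ) :
    EuclideanSpace ℝ (Fin d) → ℝ :=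
  fun x => fderiv ℝ f x (EuclideanSpace.single i 1)

/-- Laplacian on ℝ^d. -/
def euclideanLaplacian (d : ℕ) (f : EuclideanSpace ℝ (Fin d) → ℝ) :
    EuclideanSpace ℝ (Fin d) → ℝ :=
  fun x => ∑ i, coordDeriv d i (coordDeriv d i f) x

section CoordDeriv

variable {d : ℕ}

theorem ContDiff.coordDeriv {f : EuclideanSpace ℝ (Fin d) → ℝ} {m n : WithTop ℕ∞}
    (hf : ContDiff ℝ n f) (hmn : m + 1 ≤ n) (i : Fin d) : ContDiff ℝ m (coordDeriv d i f) :=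
  (hf.fderiv_right hmn).clm_apply contDiff_const

theorem HasCompactSupport.coordDeriv {f : EuclideanSpace ℝ (Fin d) → ℝ}
    (hf : HasCompactSupport f) (i : Fin d) : HasCompactSupport (coordDeriv d i f) :=
  hf.fderiv_apply (𝕜 := ℝ) _

theorem integrable_coordDeriv {f : EuclideanSpace ℝ (Fin d) → ℝ}
    (hf : ContDiff ℝ 1 f) (hfc : HasCompactSupport f) (i : Fin d) :
    Integrable (coordDeriv d i f) :=
  (hf.coordDeriv (m := 0) (by simp) i).continuous.integrable_of_hasCompactSupport
    (hfc.coordDeriv i)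

theorem integral_coordDeriv_eq_zero {f : EuclideanSpace ℝ (Fin d) → ℝ}
    (hf : ContDiff ℝ 1 f) (hfc : HasCompactSupport f) (i : Fin d) :
    ∫ x, coordDeriv d i f x = 0 := by
  have h := integral_mul_fderiv_eq_neg_fderiv_mul_of_integrable (μ := volume)
    (f := fun _ : EuclideanSpace ℝ (Fin d) => (1 : ℝ)) (g := f)
    (v := EuclideanSpace.single i 1) (by simp)
    (by simpa using! integrable_coordDeriv hf hfc i)
    (by simpa using hf.continuous.integrable_of_hasCompactSupport hfc)
    (fun _ _ => by fun_prop) (fun x _ => hf.differentiable one_ne_zero x)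
  simpa using! h

theorem coordDeriv_mul {f g : EuclideanSpace ℝ (Fin d) → ℝ}
    (hf : Differentiable ℝ f) (hg : Differentiable ℝ g) (i : Fin d)
    (x : EuclideanSpace ℝ (Fin d)) :
    coordDeriv d i (fun y => f y * g y) x
      = f x * coordDeriv d i g x + coordDeriv d i f x * g x := by
  simp only [coordDeriv]
  rw [fderiv_fun_mul (hf x) (hg x)]
  simp [mul_comm]

theorem coordDeriv_comm {f : EuclideanSpace ℝ (Fin d) → ℝ} (hf : ContDiff ℝ 2 f)
    (i j : Fin d) (x : EuclideanSpace ℝ (Fin d)) :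
    coordDeriv d i (coordDeriv d j f) x = coordDeriv d j (coordDeriv d i f) x := by
  have hd : DifferentiableAt ℝ (fderiv ℝ f) x :=
    (hf.fderiv_right (m := 1) (by norm_num)).differentiable one_ne_zero x
  have key (k l : Fin d) : coordDeriv d k (coordDeriv d l f) x
      = fderiv ℝ (fderiv ℝ f) x (EuclideanSpace.single k 1) (EuclideanSpace.single l 1) := by
    change fderiv ℝ (fun y => fderiv ℝ f y (EuclideanSpace.single l 1)) x _ = _
    rw [fderiv_clm_apply hd (differentiableAt_const _)]
    simp
  rw [key, key]
  exact hf.contDiffAt.isSymmSndFDerivAt (by simp) _ _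

theorem coordDeriv_apply {F : EuclideanSpace ℝ (Fin d) → EuclideanSpace ℝ (Fin d)}
    (hF : Differentiable ℝ F) (i j : Fin d) (x : EuclideanSpace ℝ (Fin d)) :
    coordDeriv d i (fun y => F y j) x = (fderiv ℝ F x (EuclideanSpace.single i 1)) j := by
  have h := (EuclideanSpace.proj (𝕜 := ℝ) j).hasFDerivAt.comp x (hF x).hasFDerivAt
  exact congrArg (· (EuclideanSpace.single i 1)) h.fderiv

theorem fderiv_apply_eq_sum_coordDeriv (f : EuclideanSpace ℝ (Fin d) → ℝ)
    (x v : EuclideanSpace ℝ (Fin d)) :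
    fderiv ℝ f x v = ∑ j, v j * coordDeriv d j f x := by
  conv_lhs => rw [← (EuclideanSpace.basisFun (Fin d) ℝ).sum_repr v]
  simp [coordDeriv]

/-- The Pohozaev identity for a vector field with the single component `φ` in direction `j`,
before summation over the index `i`. -/
theorem integral_coordDeriv_coordDeriv_mul {g φ : EuclideanSpace ℝ (Fin d) → ℝ}
    (hg : ContDiff ℝ 2 g) (hgc : HasCompactSupport g) (hφ : ContDiff ℝ 1 φ) (i j : Fin d) :
    ∫ x, coordDeriv d i (coordDeriv d i g) x * (φ x * coordDeriv d j g x)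
      = - (∫ x, coordDeriv d i φ x * coordDeriv d i g x * coordDeriv d j g x)
        + (1 / 2) * ∫ x, coordDeriv d i g x ^ 2 * coordDeriv d j φ x := by
  have hu (k : Fin d) : ContDiff ℝ 1 (coordDeriv d k g) := hg.coordDeriv (by norm_num) k
  have huc (k : Fin d) : HasCompactSupport (coordDeriv d k g) := hgc.coordDeriv k
  have du (k : Fin d) := (hu k).differentiable one_ne_zero
  have dφ := hφ.differentiable one_ne_zero
  have cu (k : Fin d) := (hu k).continuous
  have cuu (k l : Fin d) := ((hu k).coordDeriv (m := 0) (by simp) l).continuous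
  have cφ (k : Fin d) := (hφ.coordDeriv (m := 0) (by simp) k).continuous
  have hφ' := hφ.continuous
  have hP : ContDiff ℝ 1 (fun x => coordDeriv d i g x * (φ x * coordDeriv d j g x)) :=
    (hu i).mul (hφ.mul (hu j))
  have hPc : HasCompactSupport (fun x => coordDeriv d i g x * (φ x * coordDeriv d j g x)) :=
    (huc i).mul_right
  have hQ : ContDiff ℝ 1 (fun x => coordDeriv d i g x * (φ x * coordDeriv d i g x)) :=
    (hu i).mul (hφ.mul (hu i))
  have hQc : HasCompactSupport (fun x => coordDeriv d i g x * (φ x * coordDeriv d i g x)) :=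
    (huc i).mul_right
  have iB : Integrable
      (fun x => coordDeriv d i φ x * coordDeriv d i g x * coordDeriv d j g x) :=
    Continuous.integrable_of_hasCompactSupport (by fun_prop) (huc j).mul_left
  have iD : Integrable (fun x => coordDeriv d i g x ^ 2 * coordDeriv d j φ x) := by
    simp only [sq]
    exact Continuous.integrable_of_hasCompactSupport (by fun_prop) (huc i).mul_right.mul_right
  have iP := integrable_coordDeriv hP hPc i
  have iQ := integrable_coordDeriv hQ hQc j
  have pointwise (x) : coordDeriv d i (coordDeriv d i g) x * (φ x * coordDeriv d j g x)
      = coordDeriv d i (fun x => coordDeriv d i g x * (φ x * coordDeriv d j g x)) x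
        + (-(1 / 2) * coordDeriv d j (fun x => coordDeriv d i g x * (φ x * coordDeriv d i g x)) x
        + (-(coordDeriv d i φ x * coordDeriv d i g x * coordDeriv d j g x)
        + (1 / 2) * (coordDeriv d i g x ^ 2 * coordDeriv d j φ x))) := by
    rw [coordDeriv_mul (du i) (dφ.fun_mul (du j)), coordDeriv_mul (du i) (dφ.fun_mul (du i)),
      coordDeriv_mul dφ (du j), coordDeriv_mul dφ (du i), coordDeriv_comm hg i j]
    ring
  simp_rw [pointwise]
  have iBD := iB.fun_neg.fun_add (iD.const_mul (1 / 2))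
  rw [integral_add iP ((iQ.const_mul _).fun_add iBD), integral_add (iQ.const_mul _) iBD,
    integral_add iB.fun_neg (iD.const_mul _), integral_neg,
    integral_const_mul, integral_const_mul, integral_coordDeriv_eq_zero hP hPc,
    integral_coordDeriv_eq_zero hQ hQc]
  ring

end CoordDeriv

/-- the Pohozaev identity. For smooth compactly supported `g` and a `C¹`
vector field `F` on ℝ^d,
`∫ Δg (F·∇g) = - Σ_{i,j} ∫ ∂_iF_j ∂_ig ∂_jg + (1/2) ∫ |∇g|² (∇·F)`. -/
theorem pohozaev_identity (d : ℕ) (hd : 1 ≤ d)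
    (g : EuclideanSpace ℝ (Fin d) → ℝ) (hg : ContDiff ℝ (⊤ : ℕ∞) g) (hgc : HasCompactSupport g)
    (F : EuclideanSpace ℝ (Fin d) → EuclideanSpace ℝ (Fin d)) (hF : ContDiff ℝ 1 F) :
    ∫ x, euclideanLaplacian d g x * fderiv ℝ g x (F x) =
      - ∑ i, ∑ j, (∫ x, (fderiv ℝ F x (EuclideanSpace.single i 1)) j
            * coordDeriv d i g x * coordDeriv d j g x)
        + (1 / 2) * ∫ x, (∑ i, (coordDeriv d i g x) ^ 2)
            * (∑ j, (fderiv ℝ F x (EuclideanSpace.single j 1)) j) := by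
  have hg2 : ContDiff ℝ 2 g := hg.of_le (WithTop.coe_le_coe.mpr le_top)
  have hFj (j : Fin d) : ContDiff ℝ 1 (fun x => F x j) :=
    (EuclideanSpace.proj (𝕜 := ℝ) j).contDiff.comp hF
  have cF (j : Fin d) := (hFj j).continuous
  have dF := hF.differentiable one_ne_zero
  have cu (k : Fin d) := (hg2.coordDeriv (m := 1) (by norm_num) k).continuous
  have cuu (k : Fin d) := ((hg2.coordDeriv (m := 1) (by norm_num) k).coordDeriv (m := 0)
    (by simp) k).continuous
  have cdF (i j : Fin d) := ((hFj j).coordDeriv (m := 0) (by simp) i).continuous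
  have huc (k : Fin d) : HasCompactSupport (coordDeriv d k g) := hgc.coordDeriv k
  have iA (i j : Fin d) : Integrable
      (fun x => coordDeriv d i (coordDeriv d i g) x * (F x j * coordDeriv d j g x)) :=
    Continuous.integrable_of_hasCompactSupport (by fun_prop) (huc j).mul_left.mul_left
  have iD (i j : Fin d) : Integrable
      (fun x => coordDeriv d i g x ^ 2 * coordDeriv d j (fun y => F y j) x) := by
    simp only [sq]
    exact Continuous.integrable_of_hasCompactSupport (by fun_prop) (huc i).mul_right.mul_right
  simp_rw [euclideanLaplacian, fderiv_apply_eq_sum_coordDeriv, ← coordDeriv_apply dF,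
    Finset.sum_mul_sum]
  rw [integral_finsetSum _ fun i _ => integrable_finsetSum _ fun j _ => iA i j,
    integral_finsetSum _ fun i _ => integrable_finsetSum _ fun j _ => iD i j,
    Finset.mul_sum, ← Finset.sum_neg_distrib, ← Finset.sum_add_distrib]
  refine Finset.sum_congr rfl fun i _ => ?_
  rw [integral_finsetSum _ fun j _ => iA i j, integral_finsetSum _ fun j _ => iD i j,
    Finset.mul_sum, ← Finset.sum_neg_distrib, ← Finset.sum_add_distrib]
  exact Finset.sum_congr rfl fun j _ => integral_coordDeriv_coordDeriv_mul hg2 hgc (hFj j) i j
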